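/- arXiv:2409.01363 — 9 statements merged into one kernel-verified Lean document; each statement's English description precedes it below -/
import Mathlib

section
/- Let G = (V, E, L, λ) and H = (V, E', L, λ) be colored multigraphs on the same finite vertex set V with the same coloring λ, such that d_G(u) = d_H(u) for every u ∈ V and J_G = J_H. Then there exists a finite sequence of JDESs transforming G into H; that is, H is reachable from G under the reflexive-transitive closure of the relation 'is obtained by a single JDES'. -/
open Multiset

variable {V L : Type*}

/-- Degree of a vertex in an edge multiset: number of edge-endpoint incidences,
a self-loop contributing 2. -/
def mdeg [DecidableEq V] (E : Multiset (Sym2 V)) (u : V) : ℕ :=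
  (E.map (Sym2.lift ⟨fun a b => (if a = u then 1 else 0) + (if b = u then 1 else 0),
    fun _ _ => add_comm _ _⟩)).sum

/-- Colored degree `d^ℓ(u)`: incidences of `u` with edges whose other endpoint has color `ℓ`;
a self-loop at `u` contributes 2 to `d^{lam u}(u)`. -/
def cdeg [DecidableEq V] [DecidableEq L] (lam : V → L) (E : Multiset (Sym2 V))
    (u : V) (ℓ : L) : ℕ :=
  (E.map (Sym2.lift ⟨fun a b =>
      (if a = u ∧ lam b = ℓ then 1 else 0) + (if b = u ∧ lam a = ℓ then 1 else 0),
    fun _ _ => add_comm _ _⟩)).sum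

/-- Joint color matrix entry `J[ℓ,r]`: number of edges (with multiplicity) whose endpoint
colors are `ℓ` and `r`. -/
def JCM [DecidableEq L] (lam : V → L) (E : Multiset (Sym2 V)) (ℓ r : L) : ℕ :=
  Multiset.count s(ℓ, r) (E.map (Sym2.map lam))

/-- Result of the double edge swap removing `(u,w),(v,z)` and adding `(u,z),(w,v)`. -/
def desApply [DecidableEq V] (E : Multiset (Sym2 V)) (u w v z : V) : Multiset (Sym2 V) :=
  (E - {s(u,w), s(v,z)}) + {s(u,z), s(w,v)}

/-- The DES removing `(u,w),(v,z)` (two distinct members of `E`) and adding `(u,z),(w,v)`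
is applicable to `E` and preserves the JCM. -/
def IsJDES [DecidableEq V] [DecidableEq L] (lam : V → L) (E : Multiset (Sym2 V))
    (u w v z : V) : Prop :=
  ({s(u,w), s(v,z)} : Multiset (Sym2 V)) ≤ E ∧
    ∀ ℓ r, JCM lam (desApply E u w v z) ℓ r = JCM lam E ℓ r

/-- One step of the JDES relation between edge multisets (on the same vertex set,
with the same coloring). -/
def JDESStep [DecidableEq V] [DecidableEq L] (lam : V → L)
    (E E' : Multiset (Sym2 V)) : Prop :=
  ∃ u w v z, IsJDES lam E u w v z ∧ E' = desApply E u w v z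

/-- Sub-multiset of edges incident to at least one vertex of color `ℓ`. -/
def EClass [DecidableEq L] (lam : V → L) (ℓ : L) (E : Multiset (Sym2 V)) :
    Multiset (Sym2 V) :=
  E.filter (fun e => ℓ ∈ Sym2.map lam e)

/-- `Δ(Q,R)`: total colored-degree discrepancy. -/
def Delta [Fintype V] [Fintype L] [DecidableEq V] [DecidableEq L]
    (lam : V → L) (E E' : Multiset (Sym2 V)) : ℕ :=
  ∑ u : V, ∑ ℓ : L, ((cdeg lam E u ℓ : ℤ) - (cdeg lam E' u ℓ : ℤ)).natAbs

section JDES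

lemma JCM_add [DecidableEq L] (lam : V → L) (E F : Multiset (Sym2 V)) (ℓ r : L) :
    JCM lam (E + F) ℓ r = JCM lam E ℓ r + JCM lam F ℓ r := by
  simp [JCM]

variable [DecidableEq V]

lemma mdeg_add (E F : Multiset (Sym2 V)) (x : V) : mdeg (E + F) x = mdeg E x + mdeg F x := by
  simp [mdeg]

lemma mdeg_cons (a b : V) (E : Multiset (Sym2 V)) (x : V) :
    mdeg (s(a, b) ::ₘ E) x
      = (if a = x then 1 else 0) + (if b = x then 1 else 0) + mdeg E x := by
  simp [mdeg]

lemma desApply_pair_add (F : Multiset (Sym2 V)) (u w v z : V) :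
    desApply ({s(u, w), s(v, z)} + F) u w v z = F + {s(u, z), s(w, v)} := by
  simp only [desApply, add_tsub_cancel_left]

lemma exists_mem_of_mdeg_pos {E : Multiset (Sym2 V)} {x : V} (h : 0 < mdeg E x) :
    ∃ y, s(x, y) ∈ E := by
  induction E using Multiset.induction with
  | empty => simp [mdeg] at h
  | cons e E ih =>
    induction e with
    | _ a b =>
      rw [mdeg_cons] at h
      by_cases ha : a = x
      · exact ⟨b, by simp [ha]⟩
      by_cases hb : b = x
      · exact ⟨a, by simp [hb, Sym2.eq_swap]⟩
      obtain ⟨y, hy⟩ := ih (by simpa [ha, hb] using h)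
      exact ⟨y, Multiset.mem_cons_of_mem hy⟩

variable [DecidableEq L]

lemma jdesStep_iff (lam : V → L) (E E' : Multiset (Sym2 V)) :
    JDESStep lam E E' ↔ ∃ F u w v z, E = {s(u, w), s(v, z)} + F ∧ E' = F + {s(u, z), s(w, v)} ∧
      ∀ ℓ r, JCM lam {s(u, z), s(w, v)} ℓ r = JCM lam {s(u, w), s(v, z)} ℓ r := by
  constructor
  · rintro ⟨u, w, v, z, ⟨hle, hJ⟩, rfl⟩
    obtain ⟨F, rfl⟩ := Multiset.le_iff_exists_add.mp hle
    refine ⟨F, u, w, v, z, rfl, desApply_pair_add F u w v z, fun ℓ r => ?_⟩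
    have h := hJ ℓ r
    rw [desApply_pair_add, JCM_add, JCM_add] at h
    omega
  · rintro ⟨F, u, w, v, z, rfl, rfl, hJ⟩
    refine ⟨u, w, v, z, ⟨Multiset.le_add_right _ _, fun ℓ r => ?_⟩,
      (desApply_pair_add F u w v z).symm⟩
    rw [desApply_pair_add, JCM_add, JCM_add, hJ, add_comm]

lemma JDESStep.add_left {lam : V → L} {E E' : Multiset (Sym2 V)} (h : JDESStep lam E E')
    (D : Multiset (Sym2 V)) : JDESStep lam (D + E) (D + E') := by
  rw [jdesStep_iff] at h ⊢
  obtain ⟨F, u, w, v, z, rfl, rfl, hJ⟩ := h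
  exact ⟨D + F, u, w, v, z, add_left_comm _ _ _, (add_assoc _ _ _).symm, hJ⟩

lemma JDESStep.mdeg_eq {lam : V → L} {E E' : Multiset (Sym2 V)} (h : JDESStep lam E E')
    (x : V) : mdeg E x = mdeg E' x := by
  rw [jdesStep_iff] at h
  obtain ⟨F, u, w, v, z, rfl, rfl, -⟩ := h
  simp only [mdeg_add, Multiset.insert_eq_cons, ← Multiset.cons_zero, mdeg_cons]
  omega

lemma mdeg_eq_of_reachable {lam : V → L} {E E' : Multiset (Sym2 V)}
    (h : Relation.ReflTransGen (JDESStep lam) E E') (x : V) : mdeg E x = mdeg E' x := by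
  induction h with
  | refl => rfl
  | tail _ hs ih => exact ih.trans (hs.mdeg_eq x)

lemma JCM_eq_of_reachable {lam : V → L} {E E' : Multiset (Sym2 V)}
    (h : Relation.ReflTransGen (JDESStep lam) E E') (ℓ r : L) :
    JCM lam E ℓ r = JCM lam E' ℓ r := by
  induction h with
  | refl => rfl
  | tail _ hs ih =>
    obtain ⟨u, w, v, z, hJ, rfl⟩ := hs
    exact ih.trans (hJ.2 ℓ r).symm

/-- An endpoint of an edge can be replaced by any vertex of the same color that has an
incidence outside this edge. -/
lemma exists_reachable_mem_of_color_eq {lam : V → L} {E : Multiset (Sym2 V)} {a b x : V}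
    (hab : s(a, b) ∈ E) (hcol : lam a = lam x) (hdeg : (if b = x then 1 else 0) < mdeg E x) :
    ∃ E₁, Relation.ReflTransGen (JDESStep lam) E E₁ ∧ s(x, b) ∈ E₁ := by
  by_cases hax : a = x
  · exact ⟨E, .refl, hax ▸ hab⟩
  obtain ⟨F, rfl⟩ := Multiset.exists_cons_of_mem hab
  rw [mdeg_cons, if_neg hax] at hdeg
  obtain ⟨y, hy⟩ := exists_mem_of_mdeg_pos (E := F) (x := x) (by omega)
  obtain ⟨D, rfl⟩ := Multiset.exists_cons_of_mem hy
  refine ⟨D + {s(a, y), s(b, x)}, .single ?_, by simp [Sym2.eq_swap]⟩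
  rw [jdesStep_iff]
  refine ⟨D, a, b, x, y, by simp, rfl, fun ℓ r => ?_⟩
  simp only [JCM, Multiset.insert_eq_cons, Multiset.map_cons, Multiset.map_singleton, Sym2.map_mk,
    hcol]
  rw [Sym2.eq_swap (a := lam b)]
  exact congrArg _ (Multiset.pair_comm _ _)

/-- Any edge whose endpoints have enough incidences and whose color pair occurs in `E`
belongs to a multigraph reachable from `E`. -/
lemma exists_reachable_mem {lam : V → L} {E : Multiset (Sym2 V)} {u w : V}
    (hdegu : 0 < mdeg E u) (hdegw : (if u = w then 1 else 0) < mdeg E w)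
    (hjcm : 0 < JCM lam E (lam u) (lam w)) :
    ∃ E₁, Relation.ReflTransGen (JDESStep lam) E E₁ ∧ s(u, w) ∈ E₁ := by
  obtain ⟨a, b, hab, ha, hb⟩ : ∃ a b, s(a, b) ∈ E ∧ lam a = lam u ∧ lam b = lam w := by
    obtain ⟨e, he, hmap⟩ := Multiset.mem_map.mp (Multiset.count_pos.mp hjcm)
    induction e with
    | _ a b =>
      rw [Sym2.map_mk, Sym2.eq_iff] at hmap
      rcases hmap with ⟨h₁, h₂⟩ | ⟨h₁, h₂⟩
      · exact ⟨a, b, he, h₁, h₂⟩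
      · exact ⟨b, a, Sym2.eq_swap ▸ he, h₂, h₁⟩
  obtain ⟨E₁, hE₁, c, hc, hcol⟩ : ∃ E₁, Relation.ReflTransGen (JDESStep lam) E E₁ ∧
      ∃ c, s(c, u) ∈ E₁ ∧ lam c = lam w := by
    by_cases hbu : b = u
    · exact ⟨E, .refl, a, hbu ▸ hab, by rw [ha, ← hbu, hb]⟩
    · obtain ⟨E₁, hE₁, h⟩ := exists_reachable_mem_of_color_eq hab ha (by simpa [hbu] using hdegu)
      exact ⟨E₁, hE₁, b, Sym2.eq_swap ▸ h, hb⟩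
  obtain ⟨E₂, hE₂, h⟩ := exists_reachable_mem_of_color_eq hc hcol
    (by rwa [← mdeg_eq_of_reachable hE₁])
  exact ⟨E₂, hE₁.trans hE₂, Sym2.eq_swap ▸ h⟩

end JDES

/-- If two colored multigraphs on the same finite vertex set, with the same
coloring, have the same degree sequence and the same JCM, then one can be transformed into
the other by a finite sequence of JDESs. -/
theorem jdes_strongly_connected {V L : Type*} [Fintype V] [DecidableEq V] [DecidableEq L]
    (lam : V → L) (E E' : Multiset (Sym2 V))
    (hdeg : ∀ u : V, mdeg E u = mdeg E' u)
    (hjcm : ∀ ℓ r : L, JCM lam E ℓ r = JCM lam E' ℓ r) :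
    Relation.ReflTransGen (JDESStep lam) E E' := by
  induction E' using Multiset.induction generalizing E with
  | empty =>
    have hmap : E.map (Sym2.map lam) = 0 := by
      ext p
      induction p with
      | _ ℓ r => simpa [JCM] using hjcm ℓ r
    rw [Multiset.map_eq_zero.mp hmap]
  | cons e E' ih =>
    induction e with
    | _ u w =>
      obtain ⟨E₁, hE₁, hmem⟩ : ∃ E₁, Relation.ReflTransGen (JDESStep lam) E E₁ ∧ s(u, w) ∈ E₁ := by
        apply exists_reachable_mem
        · rw [hdeg, mdeg_cons, if_pos rfl]
          omega
        · rw [hdeg, mdeg_cons, if_pos rfl]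
          omega
        · rw [hjcm]
          simp [JCM]
      obtain ⟨F, rfl⟩ := Multiset.exists_cons_of_mem hmem
      have hreach : Relation.ReflTransGen (JDESStep lam) F E' := by
        refine ih F (fun x => ?_) (fun ℓ r => ?_)
        · have h := (mdeg_eq_of_reachable hE₁ x).symm.trans (hdeg x)
          rw [mdeg_cons, mdeg_cons] at h
          omega
        · have h := (JCM_eq_of_reachable hE₁ ℓ r).symm.trans (hjcm ℓ r)
          rw [← Multiset.singleton_add, ← Multiset.singleton_add, JCM_add, JCM_add] at h
          omega
      exact hE₁.trans (hreach.lift (s(u, w) ::ₘ ·) fun _ _ h => by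
        simpa only [Multiset.singleton_add] using h.add_left {s(u, w)})
end

section
/- (Case 0) Let (u,w), (v,z) be distinct members of the edge multiset E of a colored multigraph G with {λ(u),λ(w)} ∩ {λ(v),λ(z)} = ∅. Then neither of the two DESs involving these edges — the one producing (u,z),(w,v) and the one producing (u,v),(w,z) — is a JDES. -/
open Multiset

variable {V L : Type*}

/-- A double edge swap on two edges whose endpoint-color sets are disjoint decreases the entry of
the joint color matrix at the colors of the first edge, so it is not a JDES. -/
theorem not_isJDES_of_disjoint_colors {V L : Type*} [DecidableEq V] [DecidableEq L]
    {lam : V → L} {E : Multiset (Sym2 V)} {u w v z : V}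
    (huv : lam u ≠ lam v) (huz : lam u ≠ lam z) (hwv : lam w ≠ lam v) (hwz : lam w ≠ lam z) :
    ¬ IsJDES lam E u w v z := by
  rintro ⟨hle, hJ⟩
  obtain ⟨R, rfl⟩ := Multiset.le_iff_exists_add.mp hle
  have huz' : s(lam u, lam w) ≠ s(lam u, lam z) := by
    simp [hwz, huz]
  have hwv' : s(lam u, lam w) ≠ s(lam w, lam v) := by
    simp [huv, hwv]
  have h := hJ (lam u) (lam w)
  rw [JCM, JCM, desApply, add_tsub_cancel_left] at h
  simp only [Multiset.map_add, Multiset.insert_eq_cons, Multiset.map_cons, Multiset.map_singleton,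
    Multiset.count_add, Multiset.count_cons, Multiset.count_singleton, Sym2.map_mk,
    if_neg huz', if_neg hwv', if_true] at h
  omega

/-- **Case 0.** If the endpoint-color sets of the two distinct edges
`(u,w)` and `(v,z)` are disjoint, then neither DES involving them is a JDES. -/
theorem case0_no_jdes {V L : Type*} [DecidableEq V] [DecidableEq L]
    (lam : V → L) (E : Multiset (Sym2 V)) (u w v z : V)
    (hmem : ({s(u,w), s(v,z)} : Multiset (Sym2 V)) ≤ E)
    (h1 : lam u ≠ lam v) (h2 : lam u ≠ lam z) (h3 : lam w ≠ lam v) (h4 : lam w ≠ lam z) :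
    ¬ IsJDES lam E u w v z ∧ ¬ IsJDES lam E u w z v := by
  exact ⟨not_isJDES_of_disjoint_colors h1 h2 h3 h4,
    not_isJDES_of_disjoint_colors h2 h1 h4 h3⟩
end

section
/- (Case 3A) Let (u,u) be a self-loop and (v,z) an edge in the edge multiset E of a colored multigraph G, with u, v, z pairwise distinct and λ(u) ∈ {λ(v), λ(z)}. Then the DES replacing (u,u),(v,z) with (u,v),(u,z) is a JDES, and it is moving. -/
open Multiset

variable {V L : Type*}

/-- **Case 3A.** A self-loop `(u,u)` and an edge `(v,z)` with `u,v,z`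
pairwise distinct and `λ(u) ∈ {λ(v), λ(z)}`: the DES replacing `(u,u),(v,z)` with
`(u,v),(u,z)` is a JDES and is moving. -/
theorem case3A_jdes_moving {V L : Type*} [DecidableEq V] [DecidableEq L]
    (lam : V → L) (E : Multiset (Sym2 V)) (u v z : V)
    (h1 : s(u,u) ∈ E) (h2 : s(v,z) ∈ E)
    (huv : u ≠ v) (huz : u ≠ z) (hvz : v ≠ z)
    (hlam : lam u = lam v ∨ lam u = lam z) :
    IsJDES lam E u u v z ∧ desApply E u u v z ≠ E := by
  have hne : s(u, u) ≠ s(v, z) := by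
    simp [huv, huz]
  have hle : ({s(u, u), s(v, z)} : Multiset (Sym2 V)) ≤ E := by
    rw [Multiset.insert_eq_cons, Multiset.le_iff_subset (by simp [hne])]
    intro e he
    simp only [Multiset.mem_cons, Multiset.mem_singleton] at he
    rcases he with rfl | rfl <;> assumption
  obtain ⟨F, rfl⟩ := Multiset.le_iff_exists_add.mp hle
  refine ⟨⟨hle, fun ℓ r => ?_⟩, fun h => ?_⟩
  · unfold JCM desApply
    rw [add_tsub_cancel_left, add_comm _ F, Multiset.map_add, Multiset.map_add]
    congr 2
    simp only [Multiset.insert_eq_cons, Multiset.map_cons, Multiset.map_singleton,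
      Sym2.map_mk]
    rcases hlam with hc | hc
    · rw [← hc]
      exact Multiset.pair_comm _ _
    · rw [← hc, Sym2.eq_swap (a := lam v)]
  · unfold desApply at h
    rw [add_tsub_cancel_left, add_comm _ F] at h
    have hmem : s(u, u) ∈ ({s(u, z), s(u, v)} : Multiset (Sym2 V)) := by
      rw [add_left_cancel h]
      simp
    simp [huv, huz] at hmem
end

section
/- (Cases 3B and 3C) Let (u,w) and (u,z) be distinct members of the edge multiset E of a colored multigraph G with u, w, z pairwise distinct, and suppose λ(u) = λ(w) or λ(u) = λ(z). Then the DES replacing (u,w),(u,z) with the self-loop (u,u) and the edge (w,z) is a JDES. -/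
open Multiset

variable {V L : Type*}

/-- A double edge swap whose removed and added edges carry the same multiset of color pairs
preserves the joint color matrix. -/
theorem IsJDES.of_map_eq {V L : Type*} [DecidableEq V] [DecidableEq L]
    {lam : V → L} {E : Multiset (Sym2 V)} {u w v z : V}
    (hle : ({s(u,w), s(v,z)} : Multiset (Sym2 V)) ≤ E)
    (hmap : ({s(u,z), s(w,v)} : Multiset (Sym2 V)).map (Sym2.map lam) =
      ({s(u,w), s(v,z)} : Multiset (Sym2 V)).map (Sym2.map lam)) :
    IsJDES lam E u w v z := by
  refine ⟨hle, fun ℓ r => ?_⟩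
  rw [JCM, JCM, desApply, Multiset.map_add, hmap, ← Multiset.map_add, tsub_add_cancel_of_le hle]

/-- **Cases 3B and 3C.** Distinct edges `(u,w)` and `(u,z)` forming a wedge
(`u,w,z` pairwise distinct) with `λ(u) = λ(w)` or `λ(u) = λ(z)`: the DES replacing them
with the self-loop `(u,u)` and the edge `(w,z)` is a JDES. -/
theorem case3BC_jdes {V L : Type*} [DecidableEq V] [DecidableEq L]
    (lam : V → L) (E : Multiset (Sym2 V)) (u w z : V)
    (h1 : s(u,w) ∈ E) (h2 : s(u,z) ∈ E)
    (huw : u ≠ w) (huz : u ≠ z) (hwz : w ≠ z)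
    (hlam : lam u = lam w ∨ lam u = lam z) :
    IsJDES lam E u w z u := by
  refine IsJDES.of_map_eq ?_ ?_
  · have hne : s(u,w) ≠ s(z,u) := by
      rw [Sym2.eq_swap (a := z), ne_eq, Sym2.congr_right]
      exact hwz
    rw [Multiset.le_iff_subset (by simpa using hne)]
    simpa [Multiset.subset_iff, h1, Sym2.eq_swap (a := z)] using h2
  · rcases hlam with h | h
    · simp [← h, Sym2.eq_swap (a := lam z)]
    · simpa [← h, Sym2.eq_swap (a := lam w)] using Multiset.pair_comm _ _
end

section
/- (Cases 3D and 3E) Let (u,w) and (u,z) be distinct members of the edge multiset E of a colored multigraph G with u, w, z pairwise distinct, λ(u) ≠ λ(w), and λ(u) ≠ λ(z). Then the DES replacing (u,w),(u,z) with the self-loop (u,u) and the edge (w,z) is not a JDES, while the DES replacing (u,w),(u,z) with (u,z),(w,u) is a JDES and is a no-op. -/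
open Multiset

variable {V L : Type*}

/-- **Cases 3D and 3E.** Distinct edges `(u,w)` and `(u,z)` forming a wedge
(`u,w,z` pairwise distinct) with `λ(u) ≠ λ(w)` and `λ(u) ≠ λ(z)`: the DES replacing them
with the self-loop `(u,u)` and the edge `(w,z)` is not a JDES, while the DES replacing
`(u,w),(u,z)` with `(u,z),(w,u)` is a JDES and is a no-op. -/
theorem case3DE_jdes {V L : Type*} [DecidableEq V] [DecidableEq L]
    (lam : V → L) (E : Multiset (Sym2 V)) (u w z : V)
    (h1 : s(u,w) ∈ E) (h2 : s(u,z) ∈ E)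
    (huw : u ≠ w) (huz : u ≠ z) (hwz : w ≠ z)
    (hl1 : lam u ≠ lam w) (hl2 : lam u ≠ lam z) :
    ¬ IsJDES lam E u w z u ∧ (IsJDES lam E u w u z ∧ desApply E u w u z = E) := by
  have hne : s(u,w) ≠ s(u,z) := by simp [hwz, huz]
  refine ⟨?_, ?_⟩
  · rintro ⟨hle, hJ⟩
    obtain ⟨R, rfl⟩ := Multiset.le_iff_exists_add.mp hle
    have hloop := hJ (lam u) (lam u)
    simp [JCM, desApply, hl1, hl2] at hloop
  · have hle : ({s(u,w), s(u,z)} : Multiset (Sym2 V)) ≤ E := by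
      rw [Multiset.le_iff_subset (by simpa using hne)]
      simp [Multiset.insert_eq_cons, Multiset.cons_subset, h1, h2]
    have hnoop : desApply E u w u z = E := by
      rw [desApply, Sym2.eq_swap (a := w), Multiset.pair_comm s(u,z), tsub_add_cancel_of_le hle]
    exact ⟨⟨hle, fun ℓ r => by rw [hnoop]⟩, hnoop⟩
end

section
/- (Case 4A) Let (u,w) and (v,z) be distinct members of the edge multiset E of a colored multigraph G with u, w, v, z pairwise distinct, λ(u) = λ(v), λ(u) ≠ λ(w), λ(v) ≠ λ(z), and λ(w) ≠ λ(z). Then the DES replacing (u,w),(v,z) with (u,z),(v,w) is a JDES and is moving, while the DES replacing (u,w),(v,z) with (u,v),(w,z) is not a JDES. -/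
open Multiset

variable {V L : Type*}

/-- A swap leaves the joint color matrix unchanged exactly when the added edges have the same
multiset of color pairs as the removed ones. -/
theorem isJDES_iff [DecidableEq V] [DecidableEq L] {lam : V → L} {E : Multiset (Sym2 V)}
    {u w v z : V} :
    IsJDES lam E u w v z ↔ ({s(u, w), s(v, z)} : Multiset (Sym2 V)) ≤ E ∧
      ({s(lam u, lam z), s(lam w, lam v)} : Multiset (Sym2 L)) =
        {s(lam u, lam w), s(lam v, lam z)} := by
  refine and_congr_right fun hle => ?_
  obtain ⟨F, rfl⟩ := Multiset.le_iff_exists_add.1 hle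
  rw [Multiset.ext, Sym2.forall]
  refine forall₂_congr fun ℓ r => ?_
  simp only [JCM, desApply, add_tsub_cancel_left, Multiset.map_add, Multiset.count_add,
    Multiset.insert_eq_cons, Multiset.map_cons, Multiset.map_singleton, Sym2.map_mk]
  omega

/-- A swap is a no-op exactly when the added edges are the removed ones. -/
theorem desApply_eq_self_iff [DecidableEq V] {E : Multiset (Sym2 V)} {u w v z : V}
    (hle : ({s(u, w), s(v, z)} : Multiset (Sym2 V)) ≤ E) :
    desApply E u w v z = E ↔
      ({s(u, z), s(w, v)} : Multiset (Sym2 V)) = {s(u, w), s(v, z)} := by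
  obtain ⟨F, rfl⟩ := Multiset.le_iff_exists_add.1 hle
  rw [desApply, add_tsub_cancel_left, add_comm F, add_left_inj]

/-- **Case 4A.** Distinct edges `(u,w)`, `(v,z)` on four pairwise distinct
vertices, with `λ(u) = λ(v)`, `λ(u) ≠ λ(w)`, `λ(v) ≠ λ(z)`, `λ(w) ≠ λ(z)`: the DES
producing `(u,z),(v,w)` is a JDES and moving; the DES producing `(u,v),(w,z)` is not
a JDES. -/
theorem case4A_jdes {V L : Type*} [DecidableEq V] [DecidableEq L]
    (lam : V → L) (E : Multiset (Sym2 V)) (u w v z : V)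
    (h1 : s(u,w) ∈ E) (h2 : s(v,z) ∈ E)
    (hdist : ([u, w, v, z] : List V).Pairwise (· ≠ ·))
    (hl1 : lam u = lam v) (hl2 : lam u ≠ lam w) (hl3 : lam v ≠ lam z)
    (hl4 : lam w ≠ lam z) :
    (IsJDES lam E u w v z ∧ desApply E u w v z ≠ E) ∧ ¬ IsJDES lam E u w z v := by
  have hne : u ≠ w ∧ u ≠ v ∧ u ≠ z ∧ w ≠ v ∧ w ≠ z ∧ v ≠ z := by
    simpa [and_assoc] using hdist
  obtain ⟨-, huv, huz, -, hwz, -⟩ := hne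
  have hle : ({s(u, w), s(v, z)} : Multiset (Sym2 V)) ≤ E := by
    refine (Multiset.le_iff_subset ?_).2 ?_
    · simp [huv, huz]
    · simp [Multiset.subset_iff, h1, h2]
  refine ⟨⟨isJDES_iff.2 ⟨hle, ?_⟩, ?_⟩, ?_⟩
  · rw [hl1, Multiset.pair_comm, Sym2.eq_swap]
  · rw [Ne, desApply_eq_self_iff hle]
    intro h
    have hmem : s(u, z) ∈ ({s(u, w), s(v, z)} : Multiset (Sym2 V)) := by simp [← h]
    simp [huv, huz, huz.symm, hwz.symm] at hmem
  · rw [isJDES_iff]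
    rintro ⟨-, h⟩
    have hmem : s(lam u, lam v) ∈
        ({s(lam u, lam w), s(lam z, lam v)} : Multiset (Sym2 L)) := by simp [← h]
    rw [← hl1] at hmem hl3
    simp [hl2, hl3] at hmem
end

section
/- (Case 4B) Let (u,w) and (v,z) be distinct members of the edge multiset E of a colored multigraph G with u, w, v, z pairwise distinct, λ(u) = λ(v) = ℓ, λ(w) = λ(z) = ℓ', and ℓ ≠ ℓ'. Then the DES replacing (u,w),(v,z) with (u,z),(v,w) is a JDES and is moving, while the DES replacing (u,w),(v,z) with (u,v),(w,z) is not a JDES. -/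
open Multiset

variable {V L : Type*}

/-- **Case 4B.** Distinct edges `(u,w)`, `(v,z)` on four pairwise distinct
vertices, both bichrome with the same two colors `ℓ ≠ ℓ'` (`λ(u)=λ(v)=ℓ`, `λ(w)=λ(z)=ℓ'`):
the DES producing `(u,z),(v,w)` is a JDES and moving; the DES producing `(u,v),(w,z)` is
not a JDES. -/
theorem case4B_jdes {V L : Type*} [DecidableEq V] [DecidableEq L]
    (lam : V → L) (E : Multiset (Sym2 V)) (u w v z : V) (ℓ ℓ' : L)
    (h1 : s(u,w) ∈ E) (h2 : s(v,z) ∈ E)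
    (hdist : ([u, w, v, z] : List V).Pairwise (· ≠ ·))
    (hu : lam u = ℓ) (hv : lam v = ℓ) (hw : lam w = ℓ') (hz : lam z = ℓ')
    (hll : ℓ ≠ ℓ') :
    (IsJDES lam E u w v z ∧ desApply E u w v z ≠ E) ∧ ¬ IsJDES lam E u w z v := by
  simp only [List.pairwise_cons, List.mem_cons, List.not_mem_nil, or_false] at hdist
  obtain ⟨hu', hw', -⟩ := hdist
  have huw : u ≠ w := hu' w (by simp)
  have huv : u ≠ v := hu' v (by simp)
  have huz : u ≠ z := hu' z (by simp)
  have hwv : w ≠ v := hw' v (by simp)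
  have hwz : w ≠ z := hw' z (by simp)
  have hne : s(u, w) ≠ s(v, z) := by
    simp [huv, huz]
  have hle : ({s(u, w), s(v, z)} : Multiset (Sym2 V)) ≤ E := by
    refine (Multiset.le_iff_subset (by simp [hne])).2 fun e he => ?_
    simp only [Multiset.insert_eq_cons, Multiset.mem_cons, Multiset.mem_singleton] at he
    rcases he with rfl | rfl <;> assumption
  obtain ⟨F, rfl⟩ := Multiset.le_iff_exists_add.1 hle
  refine ⟨⟨⟨hle, fun a b => ?_⟩, fun h => ?_⟩, fun h => ?_⟩
  · simp only [JCM, desApply, add_tsub_cancel_left, Multiset.map_add, Multiset.count_add,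
      Multiset.insert_eq_cons, Multiset.map_cons, Multiset.map_singleton, Sym2.map_mk, hu, hv,
      hw, hz, Sym2.eq_swap (a := ℓ') (b := ℓ)]
    exact add_comm _ _
  · have hc := congrArg (Multiset.count s(u, w)) h
    simp [desApply, huw, huv, huz, hwv, hwz, huw.symm] at hc
  · have hc := h.2 ℓ ℓ'
    simp [JCM, desApply, Sym2.eq_swap (a := z) (b := v), hu, hv, hw, hz, hll,
      hll.symm] at hc
    omega
end

section
/- (Case 4C) Let (u,w) and (v,z) be distinct members of the edge multiset E of a colored multigraph G with u, w, v, z pairwise distinct and with at least three of the four colors λ(u), λ(w), λ(v), λ(z) equal to one another. Then both DESs involving these edges — the one replacing them with (u,z),(v,w) and the one replacing them with (u,v),(w,z) — are JDESs, and both are moving. -/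
open Multiset

variable {V L : Type*}

/-- Swapping two distinct members of an edge multiset gives a JDES when the two removed and the two
added edges have the same pairs of endpoint colors. -/
theorem isJDES_of_map_eq [DecidableEq V] [DecidableEq L] {lam : V → L} {E : Multiset (Sym2 V)}
    {u w v z : V} (hle : ({s(u,w), s(v,z)} : Multiset (Sym2 V)) ≤ E)
    (h : ({s(u,z), s(w,v)} : Multiset (Sym2 V)).map (Sym2.map lam) =
      ({s(u,w), s(v,z)} : Multiset (Sym2 V)).map (Sym2.map lam)) :
    IsJDES lam E u w v z := by
  refine ⟨hle, fun ℓ r => ?_⟩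
  unfold JCM desApply
  rw [Multiset.map_add, h, ← Multiset.map_add, tsub_add_cancel_of_le hle]

/-- A double edge swap is moving when `u` differs from `w` and `v`, and `w` differs from `z`. -/
theorem desApply_ne_self [DecidableEq V] {E : Multiset (Sym2 V)} {u w v z : V}
    (hle : ({s(u,w), s(v,z)} : Multiset (Sym2 V)) ≤ E)
    (huw : u ≠ w) (huv : u ≠ v) (hwz : w ≠ z) : desApply E u w v z ≠ E := by
  intro h
  have h' : ({s(u,z), s(w,v)} : Multiset (Sym2 V)) = {s(u,w), s(v,z)} := by
    refine add_left_cancel (a := E - {s(u,w), s(v,z)}) ?_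
    rw [tsub_add_cancel_of_le hle]
    exact h
  have hmem : s(u,z) ∈ ({s(u,w), s(v,z)} : Multiset (Sym2 V)) := by
    rw [← h']; simp
  simp only [Multiset.insert_eq_cons, Multiset.mem_cons, Multiset.mem_singleton,
    Sym2.eq_iff] at hmem
  grind

/-- **Case 4C.** Distinct edges `(u,w)`, `(v,z)` on four pairwise distinct
vertices, with at least three of the four colors `λ(u), λ(w), λ(v), λ(z)` equal to one
another: both DESs involving these edges are JDESs, and both are moving. -/
theorem case4C_jdes {V L : Type*} [DecidableEq V] [DecidableEq L]
    (lam : V → L) (E : Multiset (Sym2 V)) (u w v z : V)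
    (h1 : s(u,w) ∈ E) (h2 : s(v,z) ∈ E)
    (hdist : ([u, w, v, z] : List V).Pairwise (· ≠ ·))
    (hcol : (lam u = lam w ∧ lam u = lam v) ∨ (lam u = lam w ∧ lam u = lam z) ∨
      (lam u = lam v ∧ lam u = lam z) ∨ (lam w = lam v ∧ lam w = lam z)) :
    (IsJDES lam E u w v z ∧ desApply E u w v z ≠ E) ∧
      (IsJDES lam E u w z v ∧ desApply E u w z v ≠ E) := by
  simp only [List.pairwise_cons, List.mem_cons, List.not_mem_nil, or_false, forall_eq_or_imp,
    forall_eq] at hdist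
  obtain ⟨⟨huw, huv, huz⟩, ⟨hwv, hwz⟩, -⟩ := hdist
  have hne : s(u,w) ≠ s(v,z) := by
    rw [Ne, Sym2.eq_iff]
    tauto
  have hle : ({s(u,w), s(v,z)} : Multiset (Sym2 V)) ≤ E := by
    refine (Multiset.le_iff_subset (by simpa using hne)).2 fun e he => ?_
    simp only [Multiset.insert_eq_cons, Multiset.mem_cons, Multiset.mem_singleton] at he
    rcases he with rfl | rfl <;> assumption
  have hle' : ({s(u,w), s(z,v)} : Multiset (Sym2 V)) ≤ E := by
    rwa [Sym2.eq_swap (a := z)]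
  refine ⟨⟨isJDES_of_map_eq hle ?_, desApply_ne_self hle huw huv hwz⟩,
    isJDES_of_map_eq hle' ?_, desApply_ne_self hle' huw huz hwv⟩ <;>
  · simp only [Multiset.insert_eq_cons, Multiset.map_cons, Multiset.map_singleton, Sym2.map_mk]
    rcases hcol with ⟨h, h'⟩ | ⟨h, h'⟩ | ⟨h, h'⟩ | ⟨h, h'⟩ <;>
      simp [← h, ← h', Sym2.eq_swap, Multiset.cons_eq_cons] <;> grind
end

section
/- Let ℓ be a color and let (u,w), (v,z) be distinct members of the edge multiset E of a colored multigraph G, each incident to at least one vertex of color ℓ. Then at least one of the two DESs involving (u,w) and (v,z) is a JDES. -/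
open Multiset

variable {V L : Type*}

/-- A double edge swap preserves the JCM as soon as the exchanged endpoints on one side have
the same color. -/
theorem isJDES_of_color_eq {V L : Type*} [DecidableEq V] [DecidableEq L]
    {lam : V → L} {E : Multiset (Sym2 V)} {u w v z : V}
    (hmem : ({s(u,w), s(v,z)} : Multiset (Sym2 V)) ≤ E)
    (h : lam u = lam v ∨ lam w = lam z) : IsJDES lam E u w v z := by
  have hcolors : Multiset.map (Sym2.map lam) {s(u,z), s(w,v)} =
      Multiset.map (Sym2.map lam) {s(u,w), s(v,z)} := by
    rcases h with h | h
    · simp only [insert_eq_cons, map_cons, map_singleton, Sym2.map_mk, h]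
      rw [Sym2.eq_swap (a := lam w)]
      exact Multiset.pair_comm _ _
    · simp [h, Sym2.eq_swap]
  refine ⟨hmem, fun ℓ r => ?_⟩
  unfold JCM desApply
  rw [Multiset.map_add, hcolors, ← Multiset.map_add, tsub_add_cancel_of_le hmem]

/-- If two distinct edges `(u,w)`, `(v,z)` of `E` are each incident to
at least one vertex of color `ℓ`, then at least one of the two DESs involving them is
a JDES. -/
theorem exists_jdes_of_common_color {V L : Type*} [DecidableEq V] [DecidableEq L]
    (lam : V → L) (E : Multiset (Sym2 V)) (ℓ : L) (u w v z : V)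
    (hmem : ({s(u,w), s(v,z)} : Multiset (Sym2 V)) ≤ E)
    (h1 : lam u = ℓ ∨ lam w = ℓ) (h2 : lam v = ℓ ∨ lam z = ℓ) :
    IsJDES lam E u w v z ∨ IsJDES lam E u w z v := by
  have hmem' : ({s(u,w), s(z,v)} : Multiset (Sym2 V)) ≤ E := by
    rwa [Sym2.eq_swap (a := z)]
  rcases h1 with h1 | h1 <;> rcases h2 with h2 | h2
  · exact .inl (isJDES_of_color_eq hmem (.inl (h1.trans h2.symm)))
  · exact .inr (isJDES_of_color_eq hmem' (.inl (h1.trans h2.symm)))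
  · exact .inr (isJDES_of_color_eq hmem' (.inr (h1.trans h2.symm)))
  · exact .inl (isJDES_of_color_eq hmem (.inr (h1.trans h2.symm)))
end
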